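/- Let (p_n)_{n ≥ 1} be a strictly increasing sequence of primes, and let M be the Puiseux monoid generated by {1/(p_n p_{n+2}) : n ∈ ℕ} (the 2-prime reciprocal Puiseux monoid of (p_n)_{n ≥ 1}). Then M does not satisfy the ascending chain condition on principal ideals (ACCP); in particular, the ascending chains of principal ideals (1/p_{2n−1} + M)_{n ≥ 1} and (1/p_{2n} + M)_{n ≥ 1} do not stabilize. -/

import Mathlib

/-- `c` divides `b` in the Puiseux monoid `M`, i.e., `b = c + d` for some `d ∈ M`. -/
def DvdIn (M : AddSubmonoid ℚ) (c b : ℚ) : Prop := ∃ d ∈ M, b = c + d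

/-- `e` is an invertible element (unit) of the monoid `M`. -/
def IsUnitIn (M : AddSubmonoid ℚ) (e : ℚ) : Prop := e ∈ M ∧ ∃ f ∈ M, e + f = 0

/-- `d` is a maximal common divisor of the subset `S` of `M`: `d ∈ M` is a common divisor
of `S` in `M`, and every common divisor in `M` of `{s - d : s ∈ S}` is a unit of `M`. -/
def IsMCDIn (M : AddSubmonoid ℚ) (d : ℚ) (S : Set ℚ) : Prop :=
  d ∈ M ∧ (∀ s ∈ S, DvdIn M d s) ∧
    ∀ e ∈ M, (∀ s ∈ S, DvdIn M e (s - d)) → IsUnitIn M e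

/-- `M` is a strong MCD monoid: every nonempty subset of `M` has a maximal common divisor. -/
def StronglyMCDIn (M : AddSubmonoid ℚ) : Prop :=
  ∀ S : Set ℚ, S.Nonempty → S ⊆ (M : Set ℚ) → ∃ d, IsMCDIn M d S

/-- The principal ideal `b + M` of `M`. -/
def PIdealIn (M : AddSubmonoid ℚ) (b : ℚ) : Set ℚ := {x | DvdIn M b x}

/-- `M` satisfies the ascending chain condition on principal ideals. -/
def ACCPIn (M : AddSubmonoid ℚ) : Prop :=
  ∀ b : ℕ → ℚ, (∀ n, b n ∈ M) →
    (∀ n, PIdealIn M (b n) ⊆ PIdealIn M (b (n + 1))) →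
    ∃ N, ∀ n, N ≤ n → PIdealIn M (b n) = PIdealIn M (b N)

/-- In a monoid of nonnegative rationals, a divisor is at most the element it divides. -/
theorem DvdIn.le {M : AddSubmonoid ℚ} (hM : ∀ x ∈ M, 0 ≤ x) {b c : ℚ} (h : DvdIn M b c) :
    b ≤ c := by
  obtain ⟨d, hd, rfl⟩ := h
  linarith [hM d hd]

theorem self_mem_pIdealIn (M : AddSubmonoid ℚ) (b : ℚ) : b ∈ PIdealIn M b :=
  ⟨0, M.zero_mem, (add_zero b).symm⟩

theorem pIdealIn_subset_of_dvdIn {M : AddSubmonoid ℚ} {b c : ℚ} (h : DvdIn M c b) :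
    PIdealIn M b ⊆ PIdealIn M c := by
  rintro x ⟨e, he, rfl⟩
  obtain ⟨d, hd, rfl⟩ := h
  exact ⟨d + e, M.add_mem hd he, add_assoc c d e⟩

/-- A principal ideal of a monoid of nonnegative rationals determines its generator. -/
theorem pIdealIn_injective {M : AddSubmonoid ℚ} (hM : ∀ x ∈ M, 0 ≤ x) :
    Function.Injective (PIdealIn M) := fun b c h =>
  le_antisymm
    (DvdIn.le hM (show c ∈ PIdealIn M b from h ▸ self_mem_pIdealIn M c))
    (DvdIn.le hM (show b ∈ PIdealIn M c from h ▸ self_mem_pIdealIn M b))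

theorem not_stabilizes_pIdealIn {M : AddSubmonoid ℚ} (hM : ∀ x ∈ M, 0 ≤ x) {b : ℕ → ℚ}
    (hb : Function.Injective b) :
    ¬ ∃ N, ∀ n, N ≤ n → PIdealIn M (b n) = PIdealIn M (b N) := by
  rintro ⟨N, h⟩
  exact N.succ_ne_self (hb (pIdealIn_injective hM (h (N + 1) N.le_succ)))

/-- Let `(pₙ)` be a strictly increasing sequence of primes (indexed here by `n : ℕ`, so
`p 0` is the first term). Then the 2-prime reciprocal Puiseux monoid
`M = ⟨1/(pₙ pₙ₊₂) : n⟩` does not satisfy the ACCP; in particular, `1/pₙ ∈ M` for all `n`,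
and the two ascending chains of principal ideals `(1/p_{2n} + M)` (odd-indexed terms of
the original sequence) and `(1/p_{2n+1} + M)` (even-indexed terms) do not stabilize. -/
theorem twoPrimeReciprocal_not_accp (p : ℕ → ℕ)
    (hp : ∀ n, Nat.Prime (p n)) (hmono : StrictMono p)
    (M : AddSubmonoid ℚ)
    (hM : M = AddSubmonoid.closure
      {q : ℚ | ∃ n : ℕ, q = 1 / ((p n : ℚ) * (p (n + 2) : ℚ))}) :
    ¬ ACCPIn M ∧
      (∀ n : ℕ, (1 / (p n : ℚ)) ∈ M) ∧
      (∀ n : ℕ, PIdealIn M (1 / (p (2 * n) : ℚ)) ⊆ PIdealIn M (1 / (p (2 * n + 2) : ℚ))) ∧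
      (¬ ∃ N₀ : ℕ, ∀ n : ℕ, N₀ ≤ n →
        PIdealIn M (1 / (p (2 * n) : ℚ)) = PIdealIn M (1 / (p (2 * N₀) : ℚ))) ∧
      (∀ n : ℕ, PIdealIn M (1 / (p (2 * n + 1) : ℚ)) ⊆
        PIdealIn M (1 / (p (2 * n + 3) : ℚ))) ∧
      ¬ ∃ N₀ : ℕ, ∀ n : ℕ, N₀ ≤ n →
        PIdealIn M (1 / (p (2 * n + 1) : ℚ)) = PIdealIn M (1 / (p (2 * N₀ + 1) : ℚ)) := by
  have hpos : ∀ n, (0 : ℚ) < p n := fun n => Nat.cast_pos.mpr (hp n).pos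
  have hgen : ∀ n, 1 / ((p n : ℚ) * (p (n + 2) : ℚ)) ∈ M := fun n =>
    hM ▸ AddSubmonoid.subset_closure ⟨n, rfl⟩
  have hnonneg : ∀ x ∈ M, 0 ≤ x := by
    subst hM
    intro x hx
    induction hx using AddSubmonoid.closure_induction with
    | mem x hx => obtain ⟨n, rfl⟩ := hx; positivity
    | zero => exact le_rfl
    | add x y _ _ hx hy => exact add_nonneg hx hy
  have hmem : ∀ n, 1 / (p n : ℚ) ∈ M := by
    intro n
    convert M.nsmul_mem (hgen n) (p (n + 2)) using 1
    have h₁ := (hpos n).ne'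
    have h₂ := (hpos (n + 2)).ne'
    rw [nsmul_eq_mul]
    field_simp
  have hdvd : ∀ n, DvdIn M (1 / (p (n + 2) : ℚ)) (1 / (p n : ℚ)) := by
    intro n
    refine ⟨_, M.nsmul_mem (hgen n) (p (n + 2) - p n), ?_⟩
    have h₁ := (hpos n).ne'
    have h₂ := (hpos (n + 2)).ne'
    rw [nsmul_eq_mul, Nat.cast_sub (hmono.monotone (Nat.le_add_right n 2))]
    field_simp
    ring
  have hinj : Function.Injective fun n => 1 / (p n : ℚ) := by
    intro m n h
    exact hmono.injective (by simpa using h)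
  have heven : Function.Injective fun n => 1 / (p (2 * n) : ℚ) := fun m n h => by
    have := hinj h
    omega
  have hodd : Function.Injective fun n => 1 / (p (2 * n + 1) : ℚ) := fun m n h => by
    have := hinj h
    omega
  have hchain : ∀ n, PIdealIn M (1 / (p n : ℚ)) ⊆ PIdealIn M (1 / (p (n + 2) : ℚ)) :=
    fun n => pIdealIn_subset_of_dvdIn (hdvd n)
  exact ⟨fun h => not_stabilizes_pIdealIn hnonneg heven
      (h _ (fun n => hmem (2 * n)) fun n => hchain (2 * n)),
    hmem, fun n => hchain (2 * n), not_stabilizes_pIdealIn hnonneg heven,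
    fun n => hchain (2 * n + 1), not_stabilizes_pIdealIn hnonneg hodd⟩
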